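/- arXiv:2403.07004 — 2 statements merged into one kernel-verified Lean document; each statement's English description precedes it below -/
import Mathlib

section
/- Let A ∈ ℝ^{m×n} satisfy sign consistency, b ∈ ℝ^m, c = min_{i,j : a_{ij} ≠ 0} |a_{ij}|, C = max_{i,j} |a_{ij}|. Let (x^t)_{t ≥ 0} be a sequence in ℝ^n and (j_t)_{t ≥ 0} a sequence of coordinate indices such that for each t, x^{t+1} agrees with x^t in all coordinates except j_t and x^{t+1}_{j_t} is the unique minimizer of the univariate function t' ↦ g_{j_t}(x^t) (with coordinate j_t set to t'). If there is E_min ∈ ℝ with E_{1+C/c}(Ax^t + b) ≥ E_min for all t, then for every T ∈ ℕ, Σ_{t=0}^{T−1} ‖x^{t+1} − x^t‖_∞ ≤ (E_{1+C/c}(Ax^0 + b) − E_min)/c; in particular, for every ε > 0 the number of indices t with ‖x^{t+1} − x^t‖_∞ ≥ ε is at most (E_{1+C/c}(Ax^0 + b) − E_min)/(c·ε). -/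
/-- Sign consistency: every column of `A` has a negative and a positive entry. -/
def SignConsistent {m n : ℕ} (A : Matrix (Fin m) (Fin n) ℝ) : Prop :=
  ∀ j : Fin n, (∃ i, A i j < 0) ∧ (∃ i, 0 < A i j)

/-- `g_j(x) = max_{i : a_{ij} ≠ 0} (a_i^T x + b_i)`. -/
noncomputable def g {m n : ℕ} (A : Matrix (Fin m) (Fin n) ℝ) (b : Fin m → ℝ)
    (j : Fin n) (x : Fin n → ℝ) : ℝ :=
  ⨆ i : {i : Fin m // A i j ≠ 0}, (∑ l, A i.1 l * x l + b i.1)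

/-- The energy `E_k(y) = ∑_{i=1}^m k^i · sort(y)_i`, where `sort(y)` is `y`
sorted in ascending order. -/
noncomputable def energy (m : ℕ) (k : ℝ) (y : Fin m → ℝ) : ℝ :=
  ∑ i : Fin m, k ^ ((i : ℕ) + 1) * y (Tuple.sort y i)

/-- Sorting maximizes the weighted sum defining the energy among all arrangements. -/
lemma sum_perm_le_energy {m : ℕ} {k : ℝ} (hk : 1 ≤ k) (y : Fin m → ℝ)
    (σ : Equiv.Perm (Fin m)) :
    ∑ i : Fin m, k ^ ((i : ℕ) + 1) * y (σ i) ≤ energy m k y := by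
  have hmv : Monovary (fun i : Fin m => k ^ ((i : ℕ) + 1)) (y ∘ Tuple.sort y) :=
    Monotone.monovary (fun i j hij => pow_le_pow_right₀ hk (by simpa using hij))
      (Tuple.monotone_sort y)
  simpa [energy] using
    hmv.sum_mul_comp_perm_le_sum_mul (σ := σ.trans (Tuple.sort y).symm)

/-- The energy of `y` is realized by an arrangement that puts a given index `i₀` after every other
index with the same value. -/
lemma exists_perm_energy_eq {m : ℕ} (k : ℝ) (y : Fin m → ℝ) (i₀ : Fin m) :
    ∃ (σ : Equiv.Perm (Fin m)) (r : Fin m), σ r = i₀ ∧ (∀ q, r < q → y i₀ < y (σ q)) ∧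
      energy m k y = ∑ i : Fin m, k ^ ((i : ℕ) + 1) * y (σ i) := by
  classical
  set τ := Tuple.sort y
  have hτ : Monotone (y ∘ τ) := Tuple.monotone_sort y
  let F := Finset.univ.filter fun p => y (τ p) = y i₀
  have hF : F.Nonempty := ⟨τ.symm i₀, by simp [F]⟩
  let r := F.max' hF
  have hr : y (τ r) = y i₀ := (Finset.mem_filter.1 (F.max'_mem hF)).2
  let σ : Equiv.Perm (Fin m) := (Equiv.swap r (τ.symm i₀)).trans τ
  have hσ : ∀ q, y (σ q) = y (τ q) := by
    intro q
    rcases eq_or_ne q r with rfl | h1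
    · simp [σ, hr]
    rcases eq_or_ne q (τ.symm i₀) with rfl | h2
    · simp [σ, hr]
    · simp [σ, Equiv.swap_apply_of_ne_of_ne h1 h2]
  refine ⟨σ, r, by simp [σ], fun q hq => ?_, ?_⟩
  · rw [hσ]
    refine lt_of_le_of_ne (hr ▸ hτ hq.le) fun h => ?_
    exact absurd (F.le_max' q (by simp [F, h])) (not_le.2 hq)
  · simp only [energy, hσ]
    rfl

/-- A geometric sum below position `r` is dominated by the term at position `r`. -/
lemma geom_sum_pow_succ_le {m : ℕ} {c C δ : ℝ} (hc : 0 < c) (hC : c ≤ C) (hδ : 0 ≤ δ)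
    {v : Fin m → ℝ} (r : Fin m) (hr : v r ≤ -(c * δ)) (hv : ∀ q, v q ≤ C * δ)
    (hgt : ∀ q, r < q → v q ≤ 0) :
    ∑ q : Fin m, (1 + C / c) ^ ((q : ℕ) + 1) * v q ≤ -(c * δ) := by
  set k := 1 + C / c with hk
  have hkC : c * (k - 1) = C := by rw [hk]; field_simp; ring
  have hk1 : 1 ≤ k := by
    have : 0 ≤ C / c := div_nonneg (hc.le.trans hC) hc.le
    linarith
  have hk0 : 0 ≤ k := by linarith
  have hCδ : 0 ≤ C * δ := mul_nonneg (hc.le.trans hC) hδ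
  let w : ℕ → ℝ := fun q =>
    if q < r then k ^ (q + 1) * (C * δ) else if q = r then k ^ (q + 1) * -(c * δ) else 0
  have hle : ∑ q : Fin m, k ^ ((q : ℕ) + 1) * v q ≤ ∑ q : Fin m, w q := by
    refine Finset.sum_le_sum fun q _ => ?_
    rcases lt_trichotomy q r with h | rfl | h
    · have h' : (q : ℕ) < r := h
      simpa only [w, if_pos h'] using mul_le_mul_of_nonneg_left (hv q) (by positivity)
    · simpa [w] using mul_le_mul_of_nonneg_left hr (by positivity : 0 ≤ k ^ ((q : ℕ) + 1))
    · have h' : (r : ℕ) < q := h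
      simp only [w, if_neg h'.not_gt, if_neg h'.ne']
      exact mul_nonpos_of_nonneg_of_nonpos (by positivity) (hgt q h)
  have hsum : ∑ q : Fin m, w q
      = (∑ q ∈ Finset.range r, k ^ (q + 1)) * (C * δ) + k ^ ((r : ℕ) + 1) * -(c * δ) := by
    rw [Fin.sum_univ_eq_sum_range w m,
      ← Finset.sum_subset (Finset.range_subset_range.2 (Nat.succ_le_of_lt r.2)),
      Finset.sum_range_succ, Finset.sum_mul]
    · congr 1
      · exact Finset.sum_congr rfl fun q hq => by simp [w, Finset.mem_range.1 hq]
      · simp [w]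
    · intro q _ hq
      have h' : (r : ℕ) < q := by simpa using hq
      simp only [w, if_neg h'.not_gt, if_neg h'.ne']
  have hgeom : (∑ q ∈ Finset.range r, k ^ (q + 1)) * (k - 1) = k ^ ((r : ℕ) + 1) - k := by
    have := geom_sum_mul k r
    simp_rw [pow_succ k, ← Finset.sum_mul]
    linear_combination k * this
  have heq : ∑ q : Fin m, w q = -(k * (c * δ)) := by
    rw [hsum, ← hkC]
    linear_combination (c * δ) * hgeom
  have : c * δ ≤ k * (c * δ) := le_mul_of_one_le_left (by positivity) hk1
  linarith

/-- The energy drops by at least `c * δ` when some index decreases by at least `c * δ`, every index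
increases by at most `C * δ`, and the increased indices end up below the decreased one. -/
lemma energy_add_le {m : ℕ} {c C δ : ℝ} (hc : 0 < c) (hC : c ≤ C) (hδ : 0 ≤ δ)
    {y y' : Fin m → ℝ} (i₀ : Fin m) (h₀ : y' i₀ - y i₀ ≤ -(c * δ))
    (hinc : ∀ i, y' i - y i ≤ C * δ) (hlt : ∀ i, y' i₀ < y' i → y' i ≤ y i) :
    energy m (1 + C / c) y' + c * δ ≤ energy m (1 + C / c) y := by
  obtain ⟨σ, r, hσr, hgt, hE⟩ := exists_perm_energy_eq (1 + C / c) y' i₀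
  have hk : 1 ≤ 1 + C / c := by
    have : 0 ≤ C / c := div_nonneg (hc.le.trans hC) hc.le
    linarith
  have h1 := sum_perm_le_energy hk y σ
  have h2 := geom_sum_pow_succ_le (v := fun q => y' (σ q) - y (σ q)) hc hC hδ r
    (by simpa [hσr] using h₀) (fun q => hinc _) fun q hq => sub_nonpos.2 (hlt _ (hgt q hq))
  simp only [mul_sub, Finset.sum_sub_distrib] at h2
  linarith

/-- If moving along `d` never lowers the maximum of `y` over the support of `d`, then this maximum
is attained at an index where `d` is negative. -/
lemma exists_neg_isMax {ι : Type*} [Finite ι] {y d : ι → ℝ}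
    (h : ∀ η : ℝ, ∃ i, d i ≠ 0 ∧ ∀ i', d i' ≠ 0 → y i' ≤ y i + η * d i) :
    ∃ i, d i < 0 ∧ ∀ i', d i' ≠ 0 → y i' ≤ y i := by
  obtain ⟨i₁, hi₁, hmax⟩ := h 0
  simp only [zero_mul, add_zero] at hmax
  by_contra! hcon
  have hev : ∀ᶠ η : ℝ in nhdsWithin 0 (Set.Ioi 0), ∀ i, d i ≠ 0 → y i + -η * d i < y i₁ := by
    refine Filter.eventually_all.2 fun i => ?_
    rcases lt_trichotomy (d i) 0 with hd | hd | hd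
    · obtain ⟨i', hi', hlt⟩ := hcon i hd
      have hcont : Continuous fun η : ℝ => y i + -η * d i := by fun_prop
      have h0 : (fun η : ℝ => y i + -η * d i) 0 < y i₁ := by simpa using hlt.trans_le (hmax i' hi')
      filter_upwards [nhdsWithin_le_nhds (hcont.continuousAt.eventually_lt_const h0)] with η hη _
        using hη
    · simp [hd]
    · filter_upwards [self_mem_nhdsWithin] with η hη _
      have := mul_pos (Set.mem_Ioi.1 hη) hd
      linarith [hmax i hd.ne']
  obtain ⟨η, hη⟩ := hev.exists
  obtain ⟨i, hi, hle⟩ := h (-η)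
  exact absurd (hle i₁ hi₁) (not_le.2 (hη i hi))

lemma row_update {m n : ℕ} (A : Matrix (Fin m) (Fin n) ℝ) (x x' : Fin n → ℝ) (j : Fin n)
    (h : ∀ k, k ≠ j → x' k = x k) (i : Fin m) :
    ∑ l, A i l * x' l = ∑ l, A i l * x l + (x' j - x j) * A i j := by
  rw [← sub_eq_iff_eq_add', ← Finset.sum_sub_distrib, Finset.sum_eq_single j]
  · ring
  · intro l _ hl
    rw [h l hl, sub_self]
  · simp

/-- An exact coordinate-minimization step decreases the energy by at least `c` times its length. -/
lemma energy_step {m n : ℕ} {A : Matrix (Fin m) (Fin n) ℝ} {b : Fin m → ℝ} {c C : ℝ}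
    (hc : 0 < c) (hcC : c ≤ C) (hcA : ∀ i j, A i j ≠ 0 → c ≤ |A i j|) (hCA : ∀ i j, |A i j| ≤ C)
    {x x' : Fin n → ℝ} {j : Fin n} (hj : ∃ i, A i j ≠ 0) (hagree : ∀ k, k ≠ j → x' k = x k)
    (hmin : ∀ s : ℝ, g A b j x' ≤ g A b j (Function.update x j s)) :
    energy m (1 + C / c) (fun i => ∑ l, A i l * x' l + b i) + c * ‖x' - x‖
      ≤ energy m (1 + C / c) (fun i => ∑ l, A i l * x l + b i) := by
  set y : Fin m → ℝ := fun i => ∑ l, A i l * x l + b i with hy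
  set y' : Fin m → ℝ := fun i => ∑ l, A i l * x' l + b i with hy'
  set δ := x' j - x j with hδ
  have hyy : ∀ i, y' i - y i = δ * A i j := fun i => by
    simp only [hy, hy', row_update A x x' j hagree i]
    ring
  have hnorm : ‖x' - x‖ ≤ |δ| := by
    refine (pi_norm_le_iff_of_nonneg (abs_nonneg _)).2 fun k => ?_
    rcases eq_or_ne k j with rfl | hk
    · exact le_rfl
    · simp [hagree k hk]
  have hstat : ∀ η : ℝ, ∃ i, A i j ≠ 0 ∧ ∀ i', A i' j ≠ 0 → y' i' ≤ y' i + η * A i j := by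
    intro η
    have : Nonempty {i : Fin m // A i j ≠ 0} := hj.elim fun i hi => ⟨⟨i, hi⟩⟩
    obtain ⟨i, hi⟩ := exists_eq_ciSup_of_finite
      (f := fun i : {i : Fin m // A i j ≠ 0} =>
        ∑ l, A i.1 l * Function.update x j (x' j + η) l + b i.1)
    refine ⟨i.1, i.2, fun i' hi' => ?_⟩
    have h1 : y' i' ≤ g A b j x' :=
      le_ciSup (f := fun i : {i : Fin m // A i j ≠ 0} => ∑ l, A i.1 l * x' l + b i.1)
        (Set.finite_range _).bddAbove ⟨i', hi'⟩
    have h2 : g A b j (Function.update x j (x' j + η)) = y' i.1 + η * A i.1 j := by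
      refine hi.symm.trans ?_
      have := row_update A x' (Function.update x j (x' j + η)) j
        (fun k hk => by simp [hk, hagree k hk]) i.1
      simp only [this, hy', Function.update_self]
      ring
    exact (h1.trans (hmin _)).trans_eq h2
  have key : ∃ i, δ * A i j ≤ -(c * |δ|) ∧ ∀ i', A i' j ≠ 0 → y' i' ≤ y' i := by
    rcases le_total 0 δ with h0 | h0
    · obtain ⟨i, hi, hle⟩ := exists_neg_isMax hstat
      refine ⟨i, ?_, hle⟩
      have := hcA i j hi.ne
      rw [abs_of_neg hi] at this
      rw [abs_of_nonneg h0]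
      nlinarith
    · obtain ⟨i, hi, hle⟩ := exists_neg_isMax (y := y') (d := fun i => -A i j) fun η => by
        simpa using hstat (-η)
      have hi' : 0 < A i j := by simpa using hi
      refine ⟨i, ?_, fun i' hi' => hle i' (by simpa using hi')⟩
      have := hcA i j hi'.ne'
      rw [abs_of_pos hi'] at this
      rw [abs_of_nonpos h0]
      nlinarith
  obtain ⟨i₀, hi₀, hle⟩ := key
  have hE := energy_add_le hc hcC (abs_nonneg δ) (y := y) (y' := y') i₀ ((hyy i₀).trans_le hi₀)
    (fun i => by
      rw [hyy, mul_comm]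
      refine (le_abs_self _).trans ?_
      rw [abs_mul]
      exact mul_le_mul_of_nonneg_right (hCA i j) (abs_nonneg _))
    (fun i hi => by
      have h0 : A i j = 0 := by
        by_contra h
        exact absurd (hle i h) (not_le.2 hi)
      have := hyy i
      rw [h0, mul_zero] at this
      linarith)
  linarith [mul_le_mul_of_nonneg_left hnorm hc.le]

/-- Markov-type count: a nonnegative sequence with partial sums bounded by `B` has at most `B / ε`
terms that are at least `ε`. -/
lemma finite_and_card_le_of_sum_le {f : ℕ → ℝ} (hf : ∀ t, 0 ≤ f t) {B : ℝ}
    (hB : ∀ T : ℕ, ∑ t ∈ Finset.range T, f t ≤ B) {ε : ℝ} (hε : 0 < ε) :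
    {t : ℕ | ε ≤ f t}.Finite ∧ (Nat.card {t : ℕ | ε ≤ f t} : ℝ) ≤ B / ε := by
  have hF : ∀ F : Finset ℕ, (∀ t ∈ F, ε ≤ f t) → (F.card : ℝ) ≤ B / ε := by
    intro F h
    rw [le_div_iff₀ hε]
    obtain ⟨T, hT⟩ := F.exists_nat_subset_range
    calc (F.card : ℝ) * ε = ∑ t ∈ F, ε := by simp
      _ ≤ ∑ t ∈ F, f t := Finset.sum_le_sum h
      _ ≤ ∑ t ∈ Finset.range T, f t := Finset.sum_le_sum_of_subset_of_nonneg hT fun t _ _ => hf t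
      _ ≤ B := hB T
  have hfin : {t : ℕ | ε ≤ f t}.Finite := by
    by_contra hinf
    obtain ⟨N, hN⟩ := exists_nat_gt (B / ε)
    obtain ⟨F, hFs, hFc⟩ := Set.Infinite.exists_subset_card_eq hinf N
    have := hF F fun t ht => hFs ht
    rw [hFc] at this
    linarith
  refine ⟨hfin, ?_⟩
  have := hF hfin.toFinset fun t ht => by simpa using ht
  rwa [← Set.ncard_eq_toFinset_card _ hfin] at this

/-- along coordinate-descent iterates `x^t` (each step updates coordinate `j_t`
to the minimizer of `t' ↦ g_{j_t}`), if the energy `E_{1+C/c}(Ax^t+b)` is bounded below by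
`E_min`, then `∑_{t<T} ‖x^{t+1} − x^t‖_∞ ≤ (E_{1+C/c}(Ax^0+b) − E_min)/c` for every `T`, and
for every `ε > 0` the number of steps `t` with `‖x^{t+1} − x^t‖_∞ ≥ ε` is at most
`(E_{1+C/c}(Ax^0+b) − E_min)/(c·ε)`. -/
theorem coordinate_descent_step_bounds (m n : ℕ) (A : Matrix (Fin m) (Fin n) ℝ)
    (b : Fin m → ℝ) (hsc : SignConsistent A) (c C : ℝ)
    (hc : IsLeast {r : ℝ | ∃ i j, A i j ≠ 0 ∧ r = |A i j|} c)
    (hC : IsGreatest {r : ℝ | ∃ i j, r = |A i j|} C)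
    (x : ℕ → Fin n → ℝ) (jseq : ℕ → Fin n)
    (hagree : ∀ t : ℕ, ∀ k : Fin n, k ≠ jseq t → x (t + 1) k = x t k)
    (hmin : ∀ t : ℕ, ∀ s : ℝ,
      g A b (jseq t) (x (t + 1)) ≤ g A b (jseq t) (Function.update (x t) (jseq t) s))
    (Emin : ℝ)
    (hEmin : ∀ t : ℕ, Emin ≤ energy m (1 + C / c) (fun i => ∑ l, A i l * x t l + b i)) :
    (∀ T : ℕ, ∑ t ∈ Finset.range T, ‖x (t + 1) - x t‖
        ≤ (energy m (1 + C / c) (fun i => ∑ l, A i l * x 0 l + b i) - Emin) / c) ∧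
    (∀ ε : ℝ, 0 < ε →
      {t : ℕ | ε ≤ ‖x (t + 1) - x t‖}.Finite ∧
      (Nat.card {t : ℕ | ε ≤ ‖x (t + 1) - x t‖} : ℝ)
        ≤ (energy m (1 + C / c) (fun i => ∑ l, A i l * x 0 l + b i) - Emin) / (c * ε)) := by
  obtain ⟨⟨i₁, j₁, hne, hc₁⟩, hlow⟩ := hc
  have hc0 : 0 < c := hc₁ ▸ abs_pos.2 hne
  have hcA : ∀ i j, A i j ≠ 0 → c ≤ |A i j| := fun i j h => hlow ⟨i, j, h, rfl⟩
  have hCA : ∀ i j, |A i j| ≤ C := fun i j => hC.2 ⟨i, j, rfl⟩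
  have hcC : c ≤ C := hc₁ ▸ hCA i₁ j₁
  set E : ℕ → ℝ := fun t => energy m (1 + C / c) (fun i => ∑ l, A i l * x t l + b i) with hE
  have hstep : ∀ t, E (t + 1) + c * ‖x (t + 1) - x t‖ ≤ E t := fun t =>
    energy_step hc0 hcC hcA hCA ((hsc (jseq t)).1.imp fun _ h => h.ne) (hagree t) (hmin t)
  have hsum : ∀ T : ℕ, ∑ t ∈ Finset.range T, ‖x (t + 1) - x t‖ ≤ (E 0 - Emin) / c := by
    intro T
    rw [le_div_iff₀ hc0, Finset.sum_mul]
    calc ∑ t ∈ Finset.range T, ‖x (t + 1) - x t‖ * c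
        ≤ ∑ t ∈ Finset.range T, (E t - E (t + 1)) :=
          Finset.sum_le_sum fun t _ => by linarith [hstep t]
      _ = E 0 - E T := Finset.sum_range_sub' E T
      _ ≤ E 0 - Emin := by linarith [hEmin T]
  refine ⟨hsum, fun ε hε => ?_⟩
  rw [← div_div]
  exact finite_and_card_le_of_sum_le (fun t => norm_nonneg _) hsum hε
end

section
/- Let A ∈ ℝ^{m×n} satisfy sign consistency, b ∈ ℝ^m, c = min_{i,j : a_{ij} ≠ 0} |a_{ij}|, C = max_{i,j} |a_{ij}|. Let (x^t)_{t ≥ 0} be the sequence of coordinate-descent iterates with cyclic coordinate order, i.e., x^{t+1} agrees with x^t except in coordinate j_t = (t mod n) + 1, where x^{t+1}_{j_t} is the unique minimizer of the univariate function t' ↦ g_{j_t}(x^t) (with coordinate j_t set to t'). Assume E_{1+C/c}(Ax^t + b) is bounded below over t. Then x^t converges to a point x* ∈ ℝ^n which is a fixed point of the method: for every j ∈ {1,…,n}, max_{i : a_{ij} < 0} (a_i^T x* + b_i) = max_{i : a_{ij} > 0} (a_i^T x* + b_i). -/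
open Filter

/-- `max_{i : a_{ij} < 0} (a_i^T x + b_i)`. -/
noncomputable def negMax {m n : ℕ} (A : Matrix (Fin m) (Fin n) ℝ) (b : Fin m → ℝ)
    (j : Fin n) (x : Fin n → ℝ) : ℝ :=
  ⨆ i : {i : Fin m // A i j < 0}, (∑ l, A i.1 l * x l + b i.1)

/-- `max_{i : a_{ij} > 0} (a_i^T x + b_i)`. -/
noncomputable def posMax {m n : ℕ} (A : Matrix (Fin m) (Fin n) ℝ) (b : Fin m → ℝ)
    (j : Fin n) (x : Fin n → ℝ) : ℝ :=
  ⨆ i : {i : Fin m // 0 < A i j}, (∑ l, A i.1 l * x l + b i.1)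

/-- If no small shift of `u` in direction `a` lowers the maximum of `u` over the support of `a`,
then this maximum is attained at an index where `a` is negative. -/
lemma exists_neg_of_iSup_le {m : ℕ} {p : Fin m → Prop} (a u : Fin m → ℝ)
    (hp : ∀ i, p i ↔ a i ≠ 0) (hne : ∃ i, p i)
    (hmin : ∀ s : ℝ, (⨆ i : {i // p i}, u i) ≤ ⨆ i : {i // p i}, (u i + a i * s)) :
    ∃ i, a i < 0 ∧ ∀ k, p k → u k ≤ u i := by
  by_contra! hcon
  have : Nonempty {i // p i} := let ⟨i, hi⟩ := hne; ⟨⟨i, hi⟩⟩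
  have hle : ∀ k, p k → u k ≤ ⨆ i : {i // p i}, u i := fun k hk =>
    le_ciSup (f := fun i : {i // p i} => u i) (Set.finite_range _).bddAbove ⟨k, hk⟩
  set V := ⨆ i : {i // p i}, u i
  have hev : ∀ i : {i // p i}, ∀ᶠ s in nhdsWithin (0 : ℝ) (Set.Iio 0), u i + a i * s < V := by
    rintro ⟨i, hi⟩
    rcases lt_or_gt_of_ne ((hp i).1 hi) with hneg | hpos
    · obtain ⟨k, hk, hlt⟩ := hcon i hneg
      have hcont : Continuous fun s : ℝ => u i + a i * s := by fun_prop
      have hlt' : u i + a i * 0 < V := by simpa using hlt.trans_le (hle k hk)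
      exact nhdsWithin_le_nhds (hcont.continuousAt.eventually_lt_const hlt')
    · filter_upwards [self_mem_nhdsWithin] with s hs
      linarith [mul_neg_of_pos_of_neg hpos hs, hle i hi]
  obtain ⟨s, hs⟩ := (eventually_all.2 hev).exists
  obtain ⟨i, hi⟩ := exists_eq_ciSup_of_finite (f := fun i : {i // p i} => u i + a i * s)
  exact absurd (hmin s) (not_le.2 (hi ▸ hs i))

lemma iSup_subtype_eq_of_isMax {m : ℕ} {p q : Fin m → Prop} (u : Fin m → ℝ)
    (hpq : ∀ k, p k → q k) {i : Fin m} (hi : p i) (hmax : ∀ k, q k → u k ≤ u i) :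
    ⨆ k : {k // p k}, u k = u i := by
  have : Nonempty {k // p k} := ⟨⟨i, hi⟩⟩
  exact le_antisymm (ciSup_le fun k => hmax k (hpq k k.2))
    (le_ciSup (f := fun k : {k // p k} => u k) (Set.finite_range _).bddAbove ⟨i, hi⟩)

/-- Rearrangement inequality: sorting maximizes the weighted sum defining the energy. -/
lemma sum_comp_perm_le_energy {m : ℕ} {k : ℝ} (hk : 1 ≤ k) (y : Fin m → ℝ)
    (τ : Equiv.Perm (Fin m)) :
    ∑ i : Fin m, k ^ ((i : ℕ) + 1) * y (τ i) ≤ energy m k y := by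
  have hw : Monotone fun i : Fin m => k ^ ((i : ℕ) + 1) := fun i j hij =>
    pow_le_pow_right₀ hk (Nat.succ_le_succ hij)
  have h := (hw.monovary (Tuple.monotone_sort y)).sum_mul_comp_perm_le_sum_mul
    (σ := τ.trans (Tuple.sort y).symm)
  simpa [energy] using h

lemma energy_eq_of_monotone {m : ℕ} (k : ℝ) (y : Fin m → ℝ) (τ : Equiv.Perm (Fin m))
    (h : Monotone (y ∘ τ)) : energy m k y = ∑ i : Fin m, k ^ ((i : ℕ) + 1) * y (τ i) := by
  have := Tuple.comp_sort_eq_comp_iff_monotone.2 h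
  exact Finset.sum_congr rfl fun i _ => by rw [← Function.comp_apply (f := y), ← this]; rfl

/-- There is a sorting permutation of `u` that puts `i₀` last among its ties. -/
lemma exists_sort_last {m : ℕ} (u : Fin m → ℝ) (i₀ : Fin m) :
    ∃ τ : Equiv.Perm (Fin m), Monotone (u ∘ τ) ∧ ∀ q, τ.symm i₀ < q → u i₀ < u (τ q) := by
  let f : Fin m → ℝ ×ₗ ℕ := fun i => toLex (u i, if i = i₀ then 1 else 0)
  have hf : Monotone (f ∘ Tuple.sort f) := Tuple.monotone_sort f
  refine ⟨Tuple.sort f, fun p q hpq => ?_, fun q hq => ?_⟩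
  · rcases Prod.Lex.toLex_le_toLex.1 (hf hpq) with h | h
    · exact h.le
    · exact h.1.le
  · have hne : Tuple.sort f q ≠ i₀ := by
      intro h
      simp [← h] at hq
    have h := hf hq.le
    simp only [Function.comp_apply, Equiv.apply_symm_apply, f] at h
    rcases Prod.Lex.toLex_le_toLex.1 h with h | h
    · exact h
    · have h2 := h.2
      dsimp only at h2
      rw [if_pos trivial, if_neg hne] at h2
      omega

lemma sum_range_pow_mul_step {c C k : ℝ} (hk : c * (k - 1) = C) (p N : ℕ) :
    ∑ q ∈ Finset.range N, k ^ (q + 1) * (if q < p then C else if q = p then -c else 0) =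
      if N ≤ p then c * (k ^ (N + 1) - k) else -(c * k) := by
  induction N with
  | zero => simp
  | succ N ih =>
    rw [Finset.sum_range_succ, ih, ← hk]
    rcases lt_trichotomy N p with h | rfl | h
    · simp only [h.le, h, Nat.succ_le_of_lt h, if_true]
      ring
    · simp
      ring
    · simp [h.not_ge, h.not_gt, h.ne', show ¬ N + 1 ≤ p by omega]

lemma energy_add_le_s8 {m : ℕ} {c C k δ : ℝ} (a u : Fin m → ℝ) (hc : 0 < c) (hC : 0 ≤ C)
    (hk : c * (k - 1) = C) (hδ : 0 ≤ δ) (hle : ∀ i, a i ≤ C) {i₀ : Fin m} (hi₀ : a i₀ ≤ -c)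
    (hmax : ∀ i, a i ≠ 0 → u i ≤ u i₀) :
    energy m k u + c * k * δ ≤ energy m k (fun i => u i - a i * δ) := by
  have hk1 : 1 ≤ k := by
    by_contra! h
    nlinarith
  obtain ⟨τ, hτ, hlast⟩ := exists_sort_last u i₀
  set p := τ.symm i₀ with hp
  have hbound : ∑ q : Fin m, k ^ ((q : ℕ) + 1) * a (τ q) ≤ -(c * k) := by
    have hF : ∀ q : Fin m,
        a (τ q) ≤ if (q : ℕ) < p then C else if (q : ℕ) = p then -c else 0 := by
      intro q
      rcases lt_trichotomy (q : ℕ) p with h | h | h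
      · simpa [h] using hle _
      · have : q = p := Fin.ext h
        simpa [this, hp] using hi₀
      · have h0 : a (τ q) = 0 := by
          by_contra hne
          exact absurd (hmax _ hne) (not_le.2 (hlast q h))
        rw [if_neg h.not_gt, if_neg h.ne', h0]
    refine (Finset.sum_le_sum fun q _ =>
      mul_le_mul_of_nonneg_left (hF q) (by positivity)).trans_eq ?_
    rw [Fin.sum_univ_eq_sum_range (fun q : ℕ =>
      k ^ (q + 1) * (if q < (p : ℕ) then C else if q = (p : ℕ) then -c else 0)),
      sum_range_pow_mul_step hk, if_neg p.2.not_ge]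
  refine le_trans ?_ (sum_comp_perm_le_energy hk1 _ τ)
  rw [energy_eq_of_monotone k u τ hτ]
  have hsplit : ∑ q : Fin m, k ^ ((q : ℕ) + 1) * (u (τ q) - a (τ q) * δ) =
      ∑ q : Fin m, k ^ ((q : ℕ) + 1) * u (τ q) -
        (∑ q : Fin m, k ^ ((q : ℕ) + 1) * a (τ q)) * δ := by
    rw [Finset.sum_mul, ← Finset.sum_sub_distrib]
    exact Finset.sum_congr rfl fun q _ => by ring
  rw [hsplit]
  nlinarith [mul_le_mul_of_nonneg_right hbound hδ]

lemma continuous_iSup_of_finite {ι X : Type*} [Finite ι] [Nonempty ι] [TopologicalSpace X]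
    {f : ι → X → ℝ} (hf : ∀ i, Continuous (f i)) : Continuous fun x => ⨆ i, f i x := by
  have := Fintype.ofFinite ι
  simp_rw [← Finset.sup'_univ_eq_ciSup]
  exact Continuous.finset_sup'_apply _ fun i _ => hf i

lemma sum_mul_update {m n : ℕ} (A : Matrix (Fin m) (Fin n) ℝ) (j : Fin n) (z : Fin n → ℝ)
    (s : ℝ) (i : Fin m) :
    ∑ l, A i l * Function.update z j s l = ∑ l, A i l * z l + A i j * (s - z j) := by
  have h : ∀ l, A i l * Function.update z j s l =
      A i l * z l + if l = j then A i j * (s - z j) else 0 := by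
    intro l
    by_cases hl : l = j
    · subst hl
      simp
      ring
    · simp [hl]
  simp [h, Finset.sum_add_distrib]

lemma exists_neg_and_pos_of_g_le {m n : ℕ} (A : Matrix (Fin m) (Fin n) ℝ) (hsc : SignConsistent A)
    (b : Fin m → ℝ) (j : Fin n) (z : Fin n → ℝ)
    (hmin : ∀ s : ℝ, g A b j z ≤ g A b j (Function.update z j s)) :
    (∃ i, A i j < 0 ∧ ∀ k, A k j ≠ 0 →
      ∑ l, A k l * z l + b k ≤ ∑ l, A i l * z l + b i) ∧
    ∃ i, 0 < A i j ∧ ∀ k, A k j ≠ 0 →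
      ∑ l, A k l * z l + b k ≤ ∑ l, A i l * z l + b i := by
  obtain ⟨i, hi⟩ := (hsc j).1
  have hmin' : ∀ s : ℝ, (⨆ i : {i // A i j ≠ 0}, (∑ l, A i.1 l * z l + b i.1)) ≤
      ⨆ i : {i // A i j ≠ 0}, ((∑ l, A i.1 l * z l + b i.1) + A i.1 j * s) := by
    intro s
    refine (hmin (z j + s)).trans_eq ?_
    simp only [g, sum_mul_update, add_sub_cancel_left]
    exact congrArg iSup (funext fun i => by ring)
  refine ⟨exists_neg_of_iSup_le (fun i => A i j) (fun i => ∑ l, A i l * z l + b i)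
    (fun _ => Iff.rfl) ⟨i, hi.ne⟩ hmin', ?_⟩
  have h := exists_neg_of_iSup_le (fun i => -A i j) (fun i => ∑ l, A i l * z l + b i)
    (fun _ => neg_ne_zero.symm) ⟨i, hi.ne⟩ (fun s => by simpa only [neg_mul, mul_neg] using hmin' (-s))
  simpa only [neg_lt_zero] using h

lemma negMax_eq_posMax_of_g_le {m n : ℕ} (A : Matrix (Fin m) (Fin n) ℝ) (hsc : SignConsistent A)
    (b : Fin m → ℝ) (j : Fin n) (z : Fin n → ℝ)
    (hmin : ∀ s : ℝ, g A b j z ≤ g A b j (Function.update z j s)) :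
    negMax A b j z = posMax A b j z := by
  obtain ⟨⟨i, hi, himax⟩, i', hi', himax'⟩ := exists_neg_and_pos_of_g_le A hsc b j z hmin
  let u : Fin m → ℝ := fun i => ∑ l, A i l * z l + b i
  have h1 : negMax A b j z = u i :=
    iSup_subtype_eq_of_isMax u (fun k (hk : A k j < 0) => hk.ne) hi himax
  have h2 : posMax A b j z = u i' :=
    iSup_subtype_eq_of_isMax u (fun k (hk : 0 < A k j) => hk.ne') hi' himax'
  rw [h1, h2]
  exact le_antisymm (himax' i hi.ne) (himax i' hi'.ne.symm)

/-- An exact coordinate step from `w` to `z` decreases the energy by at least a fixed multiple of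
its length. -/
lemma energy_descent {m n : ℕ} (A : Matrix (Fin m) (Fin n) ℝ) (hsc : SignConsistent A)
    (b : Fin m → ℝ) {c C k : ℝ} (hc : 0 < c) (hC : 0 ≤ C) (hk : c * (k - 1) = C)
    (hcA : ∀ i j, A i j ≠ 0 → c ≤ |A i j|) (hCA : ∀ i j, |A i j| ≤ C)
    (j : Fin n) (w z : Fin n → ℝ) (hw : w = Function.update z j (w j))
    (hmin : ∀ s : ℝ, g A b j z ≤ g A b j (Function.update z j s)) :
    energy m k (fun i => ∑ l, A i l * z l + b i) + c * k * |z j - w j| ≤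
      energy m k (fun i => ∑ l, A i l * w l + b i) := by
  obtain ⟨⟨i, hi, himax⟩, i', hi', himax'⟩ := exists_neg_and_pos_of_g_le A hsc b j z hmin
  let u : Fin m → ℝ := fun i => ∑ l, A i l * z l + b i
  have hwu : (fun i => ∑ l, A i l * w l + b i) = fun i => u i - A i j * (z j - w j) := by
    funext i
    rw [hw, sum_mul_update, Function.update_self]
    ring
  rw [hwu]
  rcases le_total 0 (z j - w j) with hδ | hδ
  · rw [abs_of_nonneg hδ]
    refine energy_add_le_s8 (fun i => A i j) u hc hC hk hδ
      (fun i => (le_abs_self _).trans (hCA i j)) (i₀ := i) ?_ himax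
    have := hcA i j hi.ne
    rw [abs_of_neg hi] at this
    linarith
  · rw [abs_of_nonpos hδ]
    have h := energy_add_le_s8 (fun i => -A i j) u hc hC hk (neg_nonneg.2 hδ)
      (fun i => (neg_le_abs _).trans (hCA i j)) (i₀ := i') ?_
      (fun k hk => himax' k (neg_ne_zero.1 hk))
    · simpa only [neg_mul_neg] using h
    · have := hcA i' j hi'.ne'
      rw [abs_of_pos hi'] at this
      linarith

/-- coordinate descent with cyclic coordinate order (`j_t = t mod n`),
with bounded-below energy `E_{1+C/c}(Ax^t+b)`, converges to a fixed point `x*` of the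
method: `max_{i : a_{ij}<0}(a_i^T x* + b_i) = max_{i : a_{ij}>0}(a_i^T x* + b_i)` for all `j`. -/
theorem coordinate_descent_cyclic_converges_to_fixed_point
    (m n : ℕ) (hn : 0 < n) (A : Matrix (Fin m) (Fin n) ℝ)
    (b : Fin m → ℝ) (hsc : SignConsistent A) (c C : ℝ)
    (hc : IsLeast {r : ℝ | ∃ i j, A i j ≠ 0 ∧ r = |A i j|} c)
    (hC : IsGreatest {r : ℝ | ∃ i j, r = |A i j|} C)
    (x : ℕ → Fin n → ℝ)
    (hagree : ∀ t : ℕ, ∀ k : Fin n, k ≠ (⟨t % n, Nat.mod_lt t hn⟩ : Fin n) →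
      x (t + 1) k = x t k)
    (hmin : ∀ t : ℕ, ∀ s : ℝ,
      g A b (⟨t % n, Nat.mod_lt t hn⟩ : Fin n) (x (t + 1)) ≤
        g A b (⟨t % n, Nat.mod_lt t hn⟩ : Fin n)
          (Function.update (x t) (⟨t % n, Nat.mod_lt t hn⟩ : Fin n) s))
    (Emin : ℝ)
    (hEmin : ∀ t : ℕ, Emin ≤ energy m (1 + C / c) (fun i => ∑ l, A i l * x t l + b i)) :
    ∃ xstar : Fin n → ℝ,
      Tendsto x atTop (nhds xstar) ∧
      ∀ j : Fin n, negMax A b j xstar = posMax A b j xstar := by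
  obtain ⟨⟨i₁, j₁, hne₁, hc₁⟩, hcl⟩ := hc
  have hc0 : 0 < c := hc₁ ▸ abs_pos.2 hne₁
  have hCA : ∀ i j, |A i j| ≤ C := fun i j => hC.2 ⟨i, j, rfl⟩
  have hC0 : 0 ≤ C := (abs_nonneg _).trans (hCA i₁ j₁)
  have hcA : ∀ i j, A i j ≠ 0 → c ≤ |A i j| := fun i j h => hcl ⟨i, j, h, rfl⟩
  set k := 1 + C / c with hk
  have hk' : c * (k - 1) = C := by
    rw [hk]
    field_simp
    ring
  have hk0 : 0 < k := by positivity
  let J : ℕ → Fin n := fun t => ⟨t % n, Nat.mod_lt t hn⟩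
  have hup : ∀ t s, Function.update (x t) (J t) s = Function.update (x (t + 1)) (J t) s := by
    intro t s
    funext l
    by_cases hl : l = J t
    · subst hl
      simp
    · simp [hl, hagree t l hl]
  have hmin' : ∀ t s, g A b (J t) (x (t + 1)) ≤
      g A b (J t) (Function.update (x (t + 1)) (J t) s) := fun t s => hup t s ▸ hmin t s
  let E : ℕ → ℝ := fun t => energy m k (fun i => ∑ l, A i l * x t l + b i)
  have hdesc : ∀ t, E (t + 1) + c * k * |x (t + 1) (J t) - x t (J t)| ≤ E t := fun t =>
    energy_descent A hsc b hc0 hC0 hk' hcA hCA (J t) (x t) (x (t + 1))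
      (by rw [← hup, Function.update_eq_self]) (hmin' t)
  have hdist : ∀ t, dist (x t) (x (t + 1)) ≤ (E t - E (t + 1)) / (c * k) := by
    intro t
    have hd : |x (t + 1) (J t) - x t (J t)| ≤ (E t - E (t + 1)) / (c * k) := by
      rw [le_div_iff₀ (by positivity)]
      linarith [hdesc t]
    refine (dist_pi_le_iff ((abs_nonneg _).trans hd)).2 fun l => ?_
    by_cases hl : l = J t
    · rw [hl, dist_comm, Real.dist_eq]
      exact hd
    · rw [hagree t l hl, dist_self]
      exact (abs_nonneg _).trans hd
  have hsum : Summable fun t => dist (x t) (x (t + 1)) := by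
    refine summable_of_sum_range_le (c := (E 0 - Emin) / (c * k)) (fun _ => dist_nonneg) fun N => ?_
    refine (Finset.sum_le_sum fun t _ => hdist t).trans ?_
    rw [← Finset.sum_div, Finset.sum_range_sub']
    gcongr
    exact hEmin N
  obtain ⟨xstar, hx⟩ := cauchySeq_tendsto_of_complete (cauchySeq_of_summable_dist hsum)
  refine ⟨xstar, hx, fun j => ?_⟩
  have hneg : Nonempty {i // A i j < 0} := let ⟨i, hi⟩ := (hsc j).1; ⟨⟨i, hi⟩⟩
  have hpos : Nonempty {i // 0 < A i j} := let ⟨i, hi⟩ := (hsc j).2; ⟨⟨i, hi⟩⟩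
  have hcn : Continuous (negMax A b j) := continuous_iSup_of_finite fun i => by fun_prop
  have hcp : Continuous (posMax A b j) := continuous_iSup_of_finite fun i => by fun_prop
  have hφ : Tendsto (fun q : ℕ => n * q + j + 1) atTop atTop :=
    tendsto_atTop_mono (fun q => (Nat.le_mul_of_pos_left q hn).trans (by omega)) tendsto_id
  refine tendsto_nhds_unique ((hcn.tendsto xstar).comp (hx.comp hφ)) ?_
  refine ((hcp.tendsto xstar).comp (hx.comp hφ)).congr fun q => ?_
  have hJ : J (n * q + j) = j := Fin.ext (by simp [J, Nat.mod_eq_of_lt j.2])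
  have h := negMax_eq_posMax_of_g_le A hsc b _ _ (hmin' (n * q + j))
  rw [hJ] at h
  exact h.symm
end
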